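/- There exists an absolute constant C > 0 such that for every odd prime power q and every even integer w with C·q^{3/2} ≤ w ≤ N − C·q^{3/2}, one has w/q ≤ f(w) ≤ w/q + C·(w^{3/2}/q^{5/2} + 1). -/

import Mathlib

open scoped BigOperators

/-- Points (and, by self-duality of homogeneous coordinates, lines) of the
Desarguesian projective plane `PG(2,q)` over the field `F`. -/
abbrev PG (F : Type*) [Field F] := Projectivization F (Fin 3 → F)

/-- Incidence between a point and a line (the line being given by its dual
homogeneous coordinates): the dot product of representatives vanishes.
This does not depend on the choice of representatives. -/
def Incid {F : Type*} [Field F] (p l : PG F) : Prop :=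
  ∑ i, p.rep i * l.rep i = 0

/-- `𝒫ᵒ(R)`: points incident with an odd number of lines of `R`. -/
def Podd (F : Type*) [Field F] (R : Set (PG F)) : Set (PG F) :=
  {p | Odd {l ∈ R | Incid p l}.ncard}

/-- `𝒫ᵉ(R)`: points incident with an even number of lines of `R`. -/
def Peven (F : Type*) [Field F] (R : Set (PG F)) : Set (PG F) :=
  {p | Even {l ∈ R | Incid p l}.ncard}

/-- `ℒᵒ(S)`: lines meeting `S` in an odd number of points. -/
def Lodd (F : Type*) [Field F] (S : Set (PG F)) : Set (PG F) :=
  {l | Odd {p ∈ S | Incid p l}.ncard}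

/-- `ℒᵉ(S)`: lines meeting `S` in an even number of points. -/
def Leven (F : Type*) [Field F] (S : Set (PG F)) : Set (PG F) :=
  {l | Even {p ∈ S | Incid p l}.ncard}

/-- `f(r)`: the minimum size of the symmetric difference of `r` distinct lines,
i.e. the minimum of `|𝒫ᵒ(R)|` over sets `R` of exactly `r` lines. -/
noncomputable def fmin (F : Type*) [Field F] (r : ℕ) : ℕ :=
  sInf {n | ∃ R : Set (PG F), R.ncard = r ∧ (Podd F R).ncard = n}

open Projectivization in
lemma incid_iff_orth {F : Type*} [Field F] (p l : PG F) : Incid p l ↔ p.orthogonal l := by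
  conv_rhs => rw [← p.mk_rep, ← l.mk_rep]
  rw [orthogonal_mk]; rfl

lemma incid_mk {F : Type*} [Field F] (v w : Fin 3 → F) (hv : v ≠ 0) (hw : w ≠ 0) :
    Incid (Projectivization.mk F v hv) (Projectivization.mk F w hw) ↔
      v 0 * w 0 + v 1 * w 1 + v 2 * w 2 = 0 := by
  rw [incid_iff_orth, Projectivization.orthogonal_mk]
  simp [dotProduct, Fin.sum_univ_three]

lemma incid_comm {F : Type*} [Field F] (p l : PG F) : Incid p l ↔ Incid l p := by
  rw [incid_iff_orth, incid_iff_orth, Projectivization.orthogonal_comm]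

lemma Lodd_eq_Podd {F : Type*} [Field F] (S : Set (PG F)) : Lodd F S = Podd F S := by
  unfold Lodd Podd
  ext l
  simp only [Set.mem_ofPred_eq, incid_comm _ l]

open Configuration in
lemma pg_order {F : Type*} [Field F] [Fintype F] [DecidableEq F] :
    ProjectivePlane.order (PG F) (PG F) = Fintype.card F := by
  classical
  have : Fintype (PG F) := Fintype.ofFinite _
  have h1 := ProjectivePlane.card_points (PG F) (PG F)
  have h2 := Projectivization.card_of_finrank F (Fin 3 → F) (n := 3) (by simp)
  rw [Nat.card_eq_fintype_card, h1] at h2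
  simp only [Finset.sum_range_succ, Nat.card_eq_fintype_card] at h2
  generalize ProjectivePlane.order (PG F) (PG F) = a at h2
  generalize Fintype.card F = b at h2
  simp at h2
  rcases lt_trichotomy a b with h | h | h
  · nlinarith
  · exact h
  · nlinarith

open Configuration in
lemma lines_through {F : Type*} [Field F] [Fintype F] (p : PG F) :
    {l | Incid p l}.ncard = Fintype.card F + 1 := by
  classical
  rw [← pg_order, ← ProjectivePlane.lineCount_eq (P := PG F) (L := PG F) p]
  unfold lineCount
  rw [← Nat.card_coe_set_eq]
  congr 1
  simp only [incid_iff_orth]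
  rfl

open Configuration in
lemma lines_through_two {F : Type*} [Field F] [Fintype F] (p x : PG F) (h : p ≠ x) :
    {l | Incid p l ∧ Incid x l}.ncard = 1 := by
  classical
  rw [Set.ncard_eq_one]
  obtain ⟨l, hl, hl'⟩ := HasLines.existsUnique_line (PG F) (PG F) p x h
  refine ⟨l, ?_⟩
  ext m
  simp only [incid_iff_orth, Set.mem_ofPred_eq, Set.mem_singleton_iff]
  constructor
  · intro hm; exact hl' m hm
  · rintro rfl; exact hl

lemma podd_podd {F : Type*} [Field F] [Fintype F] (hq : Odd (Fintype.card F))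
    (R : Set (PG F)) (hR : Even R.ncard) : Podd F (Podd F R) = R := by
  classical
  have : Fintype (PG F) := Fintype.ofFinite _
  ext x
  -- work in ZMod 2
  have key : ∀ (Q : Set (PG F)) (y : PG F), (({l ∈ Q | Incid y l}.ncard : ℕ) : ZMod 2) =
      ∑ l : PG F, if l ∈ Q ∧ Incid y l then 1 else 0 := by
    intro Q y
    rw [Set.ncard_eq_toFinset_card']
    simp
  have h0 : ∀ y, (if y ∈ Podd F R then (1 : ZMod 2) else 0) =
      (({l ∈ R | Incid y l}.ncard : ℕ) : ZMod 2) := by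
    intro y
    split_ifs with h
    · exact ((ZMod.natCast_eq_one_iff_odd).2 h).symm
    · have : Even ({l ∈ R | Incid y l}.ncard) := by
        rw [← Nat.not_odd_iff_even]; exact h
      exact ((ZMod.natCast_eq_zero_iff_even).2 this).symm
  have hc : ∀ l, (∑ y : PG F, if Incid x y ∧ Incid y l then (1 : ZMod 2) else 0) =
      if l = x then 0 else 1 := by
    intro l
    have : (∑ y : PG F, if Incid x y ∧ Incid y l then (1 : ZMod 2) else 0) =
        (({y | Incid x y ∧ Incid l y}.ncard : ℕ) : ZMod 2) := by
      rw [Set.ncard_eq_toFinset_card']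
      simp [incid_comm _ l]
    rw [this]
    split_ifs with h
    · subst h
      simp only [and_self]
      rw [lines_through, ZMod.natCast_eq_zero_iff_even]
      exact hq.add_one
    · rw [lines_through_two _ _ (Ne.symm h)]; simp
  have hR2 : (∑ l : PG F, if l ∈ R then (1 : ZMod 2) else 0) = 0 := by
    have h := (ZMod.natCast_eq_zero_iff_even).2 hR
    rw [Set.ncard_eq_toFinset_card'] at h
    simpa using h
  have main : (({l ∈ Podd F R | Incid x l}.ncard : ℕ) : ZMod 2) = if x ∈ R then 1 else 0 := by
    rw [key]
    have e1 : ∀ y : PG F, (if y ∈ Podd F R ∧ Incid x y then (1 : ZMod 2) else 0) =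
        ∑ l : PG F, (if l ∈ R then 1 else 0) * (if Incid x y ∧ Incid y l then 1 else 0) := by
      intro y
      by_cases hy : Incid x y
      · simp only [hy, and_true, true_and]
        rw [h0, key]
        apply Finset.sum_congr rfl
        intro l _
        by_cases l ∈ R <;> simp [*]
      · simp [hy]
    rw [Finset.sum_congr rfl (fun y _ => e1 y), Finset.sum_comm]
    simp_rw [← Finset.mul_sum, hc]
    have e2 : ∀ l : PG F, (if l ∈ R then (1 : ZMod 2) else 0) * (if l = x then 0 else 1) =
        (if l ∈ R then (1 : ZMod 2) else 0) - (if l = x then (if x ∈ R then 1 else 0) else 0) := by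
      intro l
      by_cases h : l = x
      · subst h; simp
      · simp [h]
    rw [Finset.sum_congr rfl (fun y _ => e2 y), Finset.sum_sub_distrib, hR2]
    simp
  constructor
  · intro h
    have h' : Odd ({l ∈ Podd F R | Incid x l}.ncard) := h
    rw [← ZMod.natCast_eq_one_iff_odd, main] at h'
    by_contra hx
    simp [hx] at h'
  · intro h
    change Odd ({l ∈ Podd F R | Incid x l}.ncard)
    rw [← ZMod.natCast_eq_one_iff_odd, main]
    simp [h]

lemma lower_bound {F : Type*} [Field F] [Fintype F] (hq : Odd (Fintype.card F))
    (R : Set (PG F)) (hR : Even R.ncard) : R.ncard ≤ (Podd F R).ncard * Fintype.card F := by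
  classical
  have : Fintype (PG F) := Fintype.ofFinite _
  have hd := podd_podd hq R hR
  have h1 : ∀ l ∈ R.toFinset, 1 ≤ (((Podd F R).toFinset).filter (fun p => Incid p l)).card := by
    intro l hl
    have hl' : l ∈ Podd F (Podd F R) := by rw [hd]; simpa using hl
    have h2 : Odd ({p ∈ Podd F R | Incid l p}.ncard) := hl'
    have h3 := h2.pos
    rw [Set.ncard_eq_toFinset_card'] at h3
    refine h3.trans_le (Finset.card_le_card ?_)
    intro p
    simp [incid_comm l]
  have h2 : ∀ p ∈ (Podd F R).toFinset, ((R.toFinset).filter (fun l => Incid p l)).card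
      ≤ Fintype.card F := by
    intro p hp
    have hp' : Odd ({l ∈ R | Incid p l}.ncard) := by
      have : p ∈ Podd F R := by simpa using hp
      exact this
    have e : ((R.toFinset).filter (fun l => Incid p l)).card = {l ∈ R | Incid p l}.ncard := by
      rw [Set.ncard_eq_toFinset_card']
      congr 1
      ext l; simp
    have hle : {l ∈ R | Incid p l}.ncard ≤ Fintype.card F + 1 := by
      rw [← lines_through p]
      exact Set.ncard_le_ncard (fun l hl => hl.2) (Set.toFinite _)
    rw [e]
    have hne : {l ∈ R | Incid p l}.ncard ≠ Fintype.card F + 1 := by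
      intro h
      rw [h] at hp'
      exact (Nat.not_odd_iff_even.2 hq.add_one) hp'
    omega
  rw [Set.ncard_eq_toFinset_card', Set.ncard_eq_toFinset_card']
  calc R.toFinset.card = ∑ l ∈ R.toFinset, 1 := by simp
    _ ≤ ∑ l ∈ R.toFinset, (((Podd F R).toFinset).filter (fun p => Incid p l)).card :=
        Finset.sum_le_sum h1
    _ = ∑ p ∈ (Podd F R).toFinset, ((R.toFinset).filter (fun l => Incid p l)).card := by
        simp only [Finset.card_filter]
        rw [Finset.sum_comm]
    _ ≤ ∑ p ∈ (Podd F R).toFinset, Fintype.card F := Finset.sum_le_sum h2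
    _ = _ := by simp

/-- Parametrization of the lines. -/
def lnP (F : Type*) [Field F] : Option (F ⊕ F × F) → PG F
  | none => Projectivization.mk F ![0, 0, 1] (fun h => by simpa using congrFun h 2)
  | some (Sum.inl c) => Projectivization.mk F ![1, 0, -c] (fun h => by simpa using congrFun h 0)
  | some (Sum.inr (m, c)) =>
      Projectivization.mk F ![m, -1, c] (fun h => by simpa using congrFun h 1)

/-- Parametrization of the points used. -/
def ptP (F : Type*) [Field F] : F ⊕ (F ⊕ F) → PG F
  | Sum.inl m => Projectivization.mk F ![1, m, 0] (fun h => by simpa using congrFun h 0)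
  | Sum.inr (Sum.inl x) => Projectivization.mk F ![x, 0, 1] (fun h => by simpa using congrFun h 2)
  | Sum.inr (Sum.inr y) => Projectivization.mk F ![0, y, 1] (fun h => by simpa using congrFun h 2)

lemma lnP_surj {F : Type*} [Field F] : Function.Surjective (lnP F) := by
  intro l
  revert l
  refine Projectivization.ind ?_
  intro v hv
  by_cases h1 : v 1 = 0
  · by_cases h0 : v 0 = 0
    · refine ⟨none, ?_⟩
      rw [lnP, Projectivization.mk_eq_mk_iff']
      have h2 : v 2 ≠ 0 := by
        intro h2; apply hv; ext i; fin_cases i <;> simp [h0, h1, h2]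
      refine ⟨(v 2)⁻¹, ?_⟩
      ext i; fin_cases i <;> simp [h0, h1, h2]
    · refine ⟨some (Sum.inl (-(v 2 / v 0))), ?_⟩
      rw [lnP, Projectivization.mk_eq_mk_iff']
      refine ⟨(v 0)⁻¹, ?_⟩
      ext i; fin_cases i <;> simp [h0, h1, div_eq_inv_mul]
  · refine ⟨some (Sum.inr (-(v 0 / v 1), -(v 2 / v 1))), ?_⟩
    rw [lnP, Projectivization.mk_eq_mk_iff']
    refine ⟨-(v 1)⁻¹, ?_⟩
    ext i; fin_cases i <;> simp [h1, div_eq_inv_mul]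

lemma lnP_bij {F : Type*} [Field F] [Fintype F] : Function.Bijective (lnP F) := by
  classical
  have : Fintype (PG F) := Fintype.ofFinite _
  rw [Fintype.bijective_iff_surjective_and_card]
  refine ⟨lnP_surj, ?_⟩
  have h2 := Projectivization.card_of_finrank F (Fin 3 → F) (n := 3) (by simp)
  rw [Nat.card_eq_fintype_card] at h2
  rw [h2]
  simp [Finset.sum_range_succ]
  ring

lemma ptP_injOn {F : Type*} [Field F] (M X Y : Finset F) (hX : 0 ∉ X) :
    Set.InjOn (ptP F) ((M.disjSum (X.disjSum Y) : Finset _) : Set (F ⊕ (F ⊕ F))) := by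
  rintro (m | x | y) h1 (m' | x' | y') h2 h
  all_goals
    rw [ptP, ptP, Projectivization.mk_eq_mk_iff'] at h
    obtain ⟨a, ha⟩ := h
    have e0 := congrFun ha 0
    have e1 := congrFun ha 1
    have e2 := congrFun ha 2
    simp at e0 e1 e2 h1 h2
  all_goals first
    | (subst e2; simp_all; done)
    | (subst e0; simp_all; done)
    | (rw [e2] at e0; simp at e0; done)

lemma cnt_eq {F : Type*} [Field F] [Fintype F] [DecidableEq F] (M X Y : Finset F) (hX : 0 ∉ X)
    (S : Set (PG F)) (hS : S = Set.image (ptP F) ((M.disjSum (X.disjSum Y) : Finset _) : Set _))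
    (l : PG F) [DecidablePred (fun p => Incid (ptP F p) l)] :
    {p ∈ S | Incid p l}.ncard =
      (M.filter (fun m => Incid (ptP F (Sum.inl m)) l)).card +
      ((X.filter (fun x => Incid (ptP F (Sum.inr (Sum.inl x))) l)).card +
       (Y.filter (fun y => Incid (ptP F (Sum.inr (Sum.inr y))) l)).card) := by
  have e : {p ∈ S | Incid p l} = Set.image (ptP F) (((M.disjSum (X.disjSum Y)).filter
      (fun p => Incid (ptP F p) l) : Finset _) : Set _) := by
    subst hS
    ext p
    constructor
    · rintro ⟨⟨t, ht, rfl⟩, h⟩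
      exact ⟨t, by simpa using ⟨by simpa using ht, h⟩, rfl⟩
    · rintro ⟨t, ht, rfl⟩
      rw [Finset.coe_filter] at ht
      exact ⟨⟨t, ht.1, rfl⟩, ht.2⟩
  rw [e, Set.InjOn.ncard_image ((ptP_injOn M X Y hX).mono (by
    rw [Finset.coe_filter]; exact fun t ht => ht.1)), Set.ncard_coe_finset]
  rw [Finset.card_filter, Finset.sum_disjSum, Finset.sum_disjSum]
  simp only [Finset.card_filter]

lemma lodd_card_eq {F : Type*} [Field F] [Fintype F] [DecidableEq F] (M X Y : Finset F)
    (hX : 0 ∉ X) (S : Set (PG F))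
    (hS : S = Set.image (ptP F) ((M.disjSum (X.disjSum Y) : Finset _) : Set _)) :
    (Lodd F S).ncard = M.card % 2 +
      (∑ c : F, ((X.filter (fun x => x = c)).card + if c = 0 then Y.card else 0) % 2 +
       ∑ m : F, ∑ c : F, ((M.filter (fun m' => m' = m)).card +
         ((X.filter (fun x => x * m + c = 0)).card + (Y.filter (fun y => y = c)).card)) % 2) := by
  classical
  have h1 : (Lodd F S).ncard = (Set.preimage (lnP F) (Lodd F S)).ncard := by
    rw [Set.ncard_preimage_of_injective_subset_range lnP_bij.1]
    rw [lnP_surj.range_eq]; exact Set.subset_univ _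
  rw [h1, Set.ncard_eq_toFinset_card']
  have h2 : ∀ n : ℕ, n % 2 = if Odd n then 1 else 0 := by
    intro n
    split_ifs with h
    · exact Nat.odd_iff.1 h
    · exact Nat.even_iff.1 (Nat.not_odd_iff_even.1 h)
  have h3 : (Set.preimage (lnP F) (Lodd F S)).toFinset.card =
      ∑ t : Option (F ⊕ F × F), {p ∈ S | Incid p (lnP F t)}.ncard % 2 := by
    simp_rw [h2, ← Finset.card_filter]
    congr 1
    ext t
    rw [Set.mem_toFinset, Finset.mem_filter]
    simp [Lodd]
  rw [h3, Fintype.sum_option, Fintype.sum_sum_type, Fintype.sum_prod_type]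
  simp_rw [cnt_eq M X Y hX S hS]
  congr 1
  · simp [lnP, ptP, incid_mk]
  congr 1
  · apply Finset.sum_congr rfl
    intro c _
    congr 1
    simp only [lnP, ptP, incid_mk]
    by_cases hc : c = 0
    · subst hc; simp
    · simp [hc, add_neg_eq_zero]
  · apply Finset.sum_congr rfl
    intro m _
    apply Finset.sum_congr rfl
    intro c _
    congr 1
    simp only [lnP, ptP, incid_mk]
    congr 1
    · congr 1; ext m'; simp [add_neg_eq_zero]; intro _; exact eq_comm
    · congr 1
      · congr 1; ext x; simp
      · congr 1; ext x; simp [neg_add_eq_zero]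

section counting
variable {F : Type*} [Field F] [Fintype F] [DecidableEq F]

/-- number of secants of direction `m` -/
def rr (X Y : Finset F) (m : F) : ℕ := (Y.filter (fun y => -(y / m) ∈ X)).card

lemma sum_axis (X : Finset F) (hX : 0 ∉ X) (n : ℕ) :
    ∑ c : F, ((X.filter (fun x => x = c)).card + if c = 0 then n else 0) % 2
      = X.card + n % 2 := by
  have h : ∀ c : F, ((X.filter (fun x => x = c)).card + if c = 0 then n else 0) % 2 =
      (if c ∈ X then 1 else 0) + (if c = 0 then n % 2 else 0) := by
    intro c
    rw [Finset.filter_eq']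
    by_cases hc : c = 0
    · subst hc; simp [hX]
    · by_cases h : c ∈ X <;> simp [hc, h]
  rw [Finset.sum_congr rfl (fun c _ => h c), Finset.sum_add_distrib]
  simp

lemma sum_slope (M X Y : Finset F) (m : F) (hm : m ≠ 0) :
    ((∑ c : F, ((M.filter (fun m' => m' = m)).card +
         ((X.filter (fun x => x * m + c = 0)).card + (Y.filter (fun y => y = c)).card)) % 2 : ℕ) : ℤ)
      = if m ∈ M then (Fintype.card F : ℤ) - X.card - Y.card + 2 * rr X Y m
        else (X.card : ℤ) + Y.card - 2 * rr X Y m := by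
  have hx : ∀ c : F, X.filter (fun x => x * m + c = 0) = if -(c / m) ∈ X then {-(c / m)} else ∅ := by
    intro c
    rw [← Finset.filter_eq']
    congr 1
    ext x
    rw [add_eq_zero_iff_eq_neg, ← neg_div, eq_div_iff hm]
  have s1 : (∑ c : F, if -(c / m) ∈ X then (1 : ℤ) else 0) = X.card := by
    rw [Finset.sum_boole]
    congr 1
    refine Finset.card_bij (fun c _ => -(c / m)) ?_ ?_ ?_
    · intro c hc; simpa using hc
    · intro c _ c' _ h
      simpa [div_left_inj' hm] using h
    · intro x hxx
      refine ⟨-(x * m), ?_, ?_⟩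
      · simp [neg_div, hm, hxx]
      · simp [neg_div, hm]
  have s2 : (∑ c : F, if c ∈ Y then (1 : ℤ) else 0) = Y.card := by simp
  have s3 : (∑ c : F, if c ∈ Y ∧ -(c / m) ∈ X then (1 : ℤ) else 0) = rr X Y m := by
    rw [Finset.sum_boole, rr]
    congr 2
    ext c; simp
  have s4 : (∑ c : F, (1 : ℤ)) = Fintype.card F := by simp
  simp_rw [hx, Finset.filter_eq']
  push_cast
  split_ifs with h
  · rw [← s1, ← s2, ← s3, ← s4, Finset.mul_sum, ← Finset.sum_sub_distrib, ← Finset.sum_sub_distrib,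
      ← Finset.sum_add_distrib]
    apply Finset.sum_congr rfl
    intro c _
    by_cases h1 : c ∈ Y <;> by_cases h2 : -(c / m) ∈ X <;> simp [h1, h2]
  · rw [← s1, ← s2, ← s3, Finset.mul_sum, ← Finset.sum_add_distrib, ← Finset.sum_sub_distrib]
    apply Finset.sum_congr rfl
    intro c _
    by_cases h1 : c ∈ Y <;> by_cases h2 : -(c / m) ∈ X <;> simp [h1, h2]

lemma sum_rr (X Y : Finset F) (hX : 0 ∉ X) (hY : 0 ∉ Y) :
    ∑ m ∈ Finset.univ.erase (0 : F), rr X Y m = Y.card * X.card := by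
  unfold rr
  simp_rw [Finset.card_filter]
  rw [Finset.sum_comm, ← smul_eq_mul, ← Finset.sum_const]
  apply Finset.sum_congr rfl
  intro y hy
  have hy0 : y ≠ 0 := fun h => hY (h ▸ hy)
  rw [← Finset.card_filter]
  refine Finset.card_bij (fun m _ => -(y / m)) ?_ ?_ ?_
  · intro m hm; simpa using (Finset.mem_filter.1 hm).2
  · intro m hm m' hm' h
    simp only [Finset.mem_filter, Finset.mem_erase] at hm hm'
    have a := hm.1.1
    have b := hm'.1.1
    rw [neg_inj, div_eq_div_iff a b] at h
    exact (mul_left_cancel₀ hy0 h).symm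
  · intro x hx
    have hx0 : x ≠ 0 := fun h => hX (h ▸ hx)
    have e : -(y / -(y / x)) = x := by field_simp
    refine ⟨-(y / x), ?_, e⟩
    simp only [Finset.mem_filter, Finset.mem_erase, e]
    simp [hx, hx0, hy0]

lemma lodd_formula (M X Y : Finset F) (hX : 0 ∉ X) (hY : 0 ∉ Y) (hM : 0 ∉ M) (k : ℕ)
    (hXk : X.card = k) (hYk : Y.card = k) (hMe : Even M.card) (S : Set (PG F))
    (hS : S = Set.image (ptP F) ((M.disjSum (X.disjSum Y) : Finset _) : Set _)) :
    ((Lodd F S).ncard : ℤ) = 2 * k * Fintype.card F + 2 * (k % 2 : ℕ) - 2 * k ^ 2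
      + M.card * ((Fintype.card F : ℤ) - 4 * k) + 4 * ∑ m ∈ M, (rr X Y m : ℤ) := by
  rw [lodd_card_eq M X Y hX S hS, sum_axis X hX, Nat.even_iff.1 hMe,
    ← Finset.add_sum_erase _ _ (Finset.mem_univ (0 : F))]
  have e0 : (∑ c : F, ((M.filter (fun m' => m' = 0)).card +
         ((X.filter (fun x => x * 0 + c = 0)).card + (Y.filter (fun y => y = c)).card)) % 2) =
         Y.card + X.card % 2 := by
    rw [← sum_axis Y hY]
    apply Finset.sum_congr rfl
    intro c _
    congr 1
    rw [Finset.filter_eq']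
    by_cases hc : c = 0 <;> simp [hc, hM, add_comm]
  rw [e0]
  rw [Nat.cast_add, Nat.cast_add, Nat.cast_add, Nat.cast_add, Nat.cast_sum]
  rw [Finset.sum_congr rfl (fun m hm => sum_slope M X Y m (Finset.ne_of_mem_erase hm))]
  have hsub : M ⊆ Finset.univ.erase (0 : F) := by
    intro m hm
    simp only [Finset.mem_erase, Finset.mem_univ, and_true]
    rintro rfl; exact hM hm
  have e1 : ∀ m : F, (if m ∈ M then (Fintype.card F : ℤ) - X.card - Y.card + 2 * rr X Y m
        else (X.card : ℤ) + Y.card - 2 * rr X Y m) =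
        ((X.card : ℤ) + Y.card - 2 * rr X Y m) +
        (if m ∈ M then (Fintype.card F : ℤ) - 2 * X.card - 2 * Y.card + 4 * rr X Y m else 0) := by
    intro m; split_ifs <;> ring
  rw [Finset.sum_congr rfl (fun m _ => e1 m), Finset.sum_add_distrib, Finset.sum_sub_distrib,
    ← Finset.mul_sum, ← Nat.cast_sum, sum_rr X Y hX hY, ← Finset.sum_filter]
  have e2 : (Finset.univ.erase (0 : F)).filter (· ∈ M) = M := by
    ext m; simp only [Finset.mem_filter]; exact ⟨fun h => h.2, fun h => ⟨hsub h, h⟩⟩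
  rw [e2, Finset.sum_add_distrib, Finset.sum_add_distrib, ← Finset.mul_sum]
  simp only [Finset.sum_const]
  rw [Finset.card_erase_of_mem (Finset.mem_univ _), Finset.card_univ, hXk, hYk]
  have hq : 1 ≤ Fintype.card F := Fintype.card_pos
  simp only [nsmul_eq_mul]
  push_cast [hq]
  ring

end counting

lemma subset_sum (k : ℕ) : ∀ T : ℕ, 2 * T ≤ k * (k + 1) →
    ∃ E ⊆ Finset.range k, ∑ n ∈ E, (n + 1) = T := by
  induction k with
  | zero => intro T hT; exact ⟨∅, by simp, by simp; omega⟩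
  | succ k ih =>
    intro T hT
    by_cases h : k + 1 ≤ T
    · obtain ⟨E, hE, hs⟩ := ih (T - (k + 1)) (by
        zify [h]; push_cast at hT; zify at hT; nlinarith)
      have hk : k ∉ E := fun hk => by simpa using hE hk
      refine ⟨insert k E, ?_, ?_⟩
      · rw [Finset.range_add_one]; exact Finset.insert_subset_insert _ hE
      · rw [Finset.sum_insert hk, hs]; omega
    · obtain ⟨E, hE, hs⟩ := ih T (by
        rcases Nat.eq_zero_or_pos k with h0 | h0
        · subst h0; omega
        · nlinarith)
      exact ⟨E, hE.trans (by simp), hs⟩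

lemma subset_sum' (k T : ℕ) (hT : 2 * T ≤ k * (k + 1)) :
    ∃ E ⊆ Finset.range k, ∑ n ∈ E, (k - n) = T := by
  obtain ⟨E, hE, hs⟩ := subset_sum k T hT
  refine ⟨E.image (fun n => k - 1 - n), ?_, ?_⟩
  · intro n hn
    simp only [Finset.mem_image] at hn
    obtain ⟨m, hm, rfl⟩ := hn
    have := hE hm
    simp at this ⊢
    omega
  · rw [Finset.sum_image, ← hs]
    · apply Finset.sum_congr rfl
      intro n hn
      have := hE hn
      simp at this
      omega
    · intro a ha b hb h
      have h1 := hE ha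
      have h2 := hE hb
      simp at h1 h2 h
      omega

lemma exists_E (k T a q : ℕ) (hT : 2 * T ≤ k * (k + 1)) (ha : k ≤ a) (hq : a + 2 * k ≤ q) :
    ∃ E ⊆ Finset.range (q - k), E.card = a ∧ ∑ n ∈ E, (k - n) = T := by
  obtain ⟨E1, h1, hs⟩ := subset_sum' k T hT
  have hc : E1.card ≤ k := by simpa using Finset.card_le_card h1
  obtain ⟨E2, h2, hc2⟩ := Finset.exists_subset_card_eq (s := Finset.Ico k (q - k)) (n := a - E1.card)
    (by simp; omega)
  have hd : Disjoint E1 E2 := by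
    rw [Finset.disjoint_left]
    intro n hn1 hn2
    have := h1 hn1
    have := h2 hn2
    simp at *
    omega
  refine ⟨E1 ∪ E2, ?_, ?_, ?_⟩
  · intro n hn
    rcases Finset.mem_union.1 hn with hn | hn
    · have := h1 hn
      simp at *
      omega
    · have := h2 hn
      simp at *
      omega
  · rw [Finset.card_union_of_disjoint hd]; omega
  · rw [Finset.sum_union hd, hs, Finset.sum_eq_zero (s := E2)]
    · simp
    · intro n hn
      have := h2 hn
      simp at this
      omega

lemma construct {F : Type*} [Field F] [Fintype F] (k s T : ℕ) (hk1 : 1 ≤ k) (hk : 3 * k ≤ s)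
    (hs : s ≤ Fintype.card F) (hse : Even s) (hT : 2 * T ≤ k * (k + 1)) :
    ∃ S : Set (PG F), S.ncard = s ∧ ((Lodd F S).ncard : ℤ) =
      s * Fintype.card F - 4 * k * s + 6 * k ^ 2 + 2 * (k % 2 : ℕ) + 4 * T := by
  classical
  set q := Fintype.card F with hq
  obtain ⟨g, hg⟩ := IsCyclic.exists_generator (α := Fˣ)
  have ho : orderOf g = q - 1 := by
    rw [orderOf_eq_card_of_forall_mem_zpowers hg, Nat.card_eq_fintype_card, Fintype.card_units]
  let G : ℕ → F := fun n => ((g ^ n : Fˣ) : F)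
  have hG0 : ∀ n, G n ≠ 0 := fun n => Units.ne_zero _
  have hGadd : ∀ i n, G (i + n) = G i * G n := by
    intro i n; simp [G, pow_add]
  have hGi : ∀ i j, i < q - 1 → j < q - 1 → G i = G j → i = j := by
    intro i j hi hj h
    have h' : g ^ i = g ^ j := Units.ext h
    rw [pow_eq_pow_iff_modEq, ho] at h'
    exact Nat.ModEq.eq_of_lt_of_lt h' hi hj
  obtain ⟨E, hE, hEc, hEs⟩ := exists_E k T (s - 2 * k) q hT (by omega) (by omega)
  have hElt : ∀ n ∈ E, n < q - k := fun n hn => by simpa using hE hn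
  let Y := (Finset.range k).image G
  let X := (Finset.range k).image (fun i => -G i)
  let M := E.image G
  have hX : (0 : F) ∉ X := by
    simp [X, hG0]
  have hY : (0 : F) ∉ Y := by
    simp [Y, hG0]
  have hM : (0 : F) ∉ M := by
    simp [M, hG0]
  have hXk : X.card = k := by
    rw [Finset.card_image_of_injOn, Finset.card_range]
    intro i hi j hj h
    simp at hi hj
    exact hGi i j (by omega) (by omega) (neg_injective h)
  have hYk : Y.card = k := by
    rw [Finset.card_image_of_injOn, Finset.card_range]
    intro i hi j hj h
    simp at hi hj
    exact hGi i j (by omega) (by omega) h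
  have hMinj : Set.InjOn G E := by
    intro i hi j hj h
    have := hElt i hi
    have := hElt j hj
    exact hGi i j (by omega) (by omega) h
  have hMk : M.card = s - 2 * k := by
    rw [Finset.card_image_of_injOn hMinj, hEc]
  have hr : ∀ n < q - k, rr X Y (G n) = k - n := by
    intro n hn
    have : Y.filter (fun y => -(y / G n) ∈ X) = (Finset.Ico n k).image G := by
      ext y
      simp only [Finset.mem_filter, Finset.mem_image, Finset.mem_range, Finset.mem_Ico, X, Y]
      constructor
      · rintro ⟨⟨j, hj, rfl⟩, i, hi, h⟩
        rw [neg_inj, eq_div_iff (hG0 n), ← hGadd] at h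
        have := hGi _ _ (by omega) (by omega) h
        exact ⟨j, by omega, rfl⟩
      · rintro ⟨j, hj, rfl⟩
        refine ⟨⟨j, by omega, rfl⟩, j - n, by omega, ?_⟩
        rw [neg_inj, eq_div_iff (hG0 n), ← hGadd, Nat.sub_add_cancel hj.1]
    rw [rr, this, Finset.card_image_of_injOn, Nat.card_Ico]
    intro i hi j hj h
    simp at hi hj
    exact hGi i j (by omega) (by omega) h
  have hsum : ∑ m ∈ M, (rr X Y m : ℤ) = T := by
    rw [← Nat.cast_sum, Finset.sum_image hMinj, ← hEs]
    congr 1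
    exact Finset.sum_congr rfl (fun n hn => hr n (hElt n hn))
  refine ⟨Set.image (ptP F) ((M.disjSum (X.disjSum Y) : Finset _) : Set _), ?_, ?_⟩
  rotate_left
  · rw [lodd_formula M X Y hX hY hM k hXk hYk (by rw [hMk]; exact hse.tsub (by simp)) _ rfl,
      hsum, hMk]
    push_cast [show 2 * k ≤ s by omega]
    ring
  · rw [Set.InjOn.ncard_image (ptP_injOn M X Y hX), Set.ncard_coe_finset, Finset.card_disjSum,
      Finset.card_disjSum, hXk, hYk, hMk]
    omega

set_option maxHeartbeats 2000000 in
lemma numerics (q w : ℕ) (hqo : Odd q) (hwe : Even w) (t u : ℝ) (ht : 0 ≤ t) (hu : 0 ≤ u)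
    (htq : t ^ 2 = q) (htu : t ^ 2 * u ^ 2 = w) (h1 : 10000 * t ^ 3 ≤ w)
    (h2 : (w : ℝ) ≤ (q : ℝ) ^ 2 + q + 1 - 10000 * t ^ 3) :
    ∃ k s T : ℕ, 1 ≤ k ∧ 3 * k ≤ s ∧ s ≤ q ∧ Even s ∧ 2 * T ≤ k * (k + 1) ∧
      (w : ℤ) = s * q - 4 * k * s + 6 * k ^ 2 + 2 * (k % 2 : ℕ) + 4 * T ∧
      (s : ℝ) ≤ u ^ 2 + 24 * u ^ 3 / t ^ 2 + 4 := by
  have hq1 : (1 : ℝ) ≤ q := by exact_mod_cast hqo.pos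
  have ht1 : 1 ≤ t := by nlinarith
  have ht2 : 0 < t ^ 2 := by positivity
  have hu1 : 10000 * t ≤ u ^ 2 := by
    rw [← htu] at h1
    have : t ^ 2 * (10000 * t) ≤ t ^ 2 * u ^ 2 := by linarith
    exact le_of_mul_le_mul_left this ht2
  have hu2 : u ^ 2 ≤ t ^ 2 + 2 - 10000 * t := by
    rw [← htu, ← htq] at h2
    have : t ^ 2 * u ^ 2 ≤ t ^ 2 * (t ^ 2 + 2 - 10000 * t) := by nlinarith
    exact le_of_mul_le_mul_left this ht2
  have hut2 : u ^ 2 ≤ t ^ 2 := by linarith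
  have hut : u ≤ t := by nlinarith
  have hu100 : 100 ≤ u := by nlinarith
  obtain ⟨v, hv⟩ : ∃ v : ℝ, v = 24 * u ^ 3 / t ^ 2 := ⟨_, rfl⟩
  have hvt : t ^ 2 * v = 24 * u ^ 3 := by rw [hv]; field_simp
  have hv0 : 0 ≤ v := by rw [hv]; positivity
  have hvu : v ≤ 24 * u := by
    have : t ^ 2 * v ≤ t ^ 2 * (24 * u) := by
      rw [hvt]; nlinarith
    exact le_of_mul_le_mul_left this ht2
  rw [← hv]
  -- choice of s
  obtain ⟨s, hs1, hs2, hs4⟩ : ∃ s : ℕ, u ^ 2 + v ≤ s ∧ (s : ℝ) ≤ u ^ 2 + v + 4 ∧ s % 4 = w % 4 := by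
    refine ⟨⌈u ^ 2 + v⌉₊ + ((w + 3 * ⌈u ^ 2 + v⌉₊) % 4), ?_, ?_, by omega⟩
    · have := Nat.le_ceil (u ^ 2 + v)
      push_cast
      have h : (0 : ℝ) ≤ (((w + 3 * ⌈u ^ 2 + v⌉₊) % 4 : ℕ) : ℝ) := by positivity
      push_cast at h
      linarith
    · have := Nat.ceil_lt_add_one (a := u ^ 2 + v) (by positivity)
      have h : (((w + 3 * ⌈u ^ 2 + v⌉₊) % 4 : ℕ) : ℝ) ≤ 3 := by
        have : (w + 3 * ⌈u ^ 2 + v⌉₊) % 4 ≤ 3 := by omega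
        exact_mod_cast this
      rw [Nat.cast_add]
      linarith
  have hs2u : (s : ℝ) ≤ 2 * u ^ 2 := by nlinarith
  have hsu : u ^ 2 ≤ s := by linarith
  have hsq : s ≤ q := by
    have : (s : ℝ) ≤ q := by rw [← htq]; linarith
    exact_mod_cast this
  have hse : Even s := by
    rw [Nat.even_iff] at hwe ⊢; omega
  obtain ⟨d, hd⟩ : ∃ d : ℤ, d = s * q - w := ⟨_, rfl⟩
  have hdr : (d : ℝ) = t ^ 2 * (s - u ^ 2) := by
    rw [hd]; push_cast; rw [← htu, ← htq]; ring
  have hd1 : 24 * u ^ 3 ≤ (d : ℝ) := by rw [hdr, ← hvt]; nlinarith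
  have hd2 : (d : ℝ) ≤ 24 * u ^ 3 + 4 * t ^ 2 := by rw [hdr, ← hvt]; nlinarith
  have hd4 : (4 : ℤ) ∣ d := by
    obtain ⟨a, ha⟩ := hse
    obtain ⟨b, hb⟩ := hqo
    have e : d = (s - w) + 4 * (a * b) := by
      rw [hd, ha, hb]; push_cast; ring
    rw [e]
    omega
  let g : ℕ → ℤ := fun k => 4 * k * s - 6 * k ^ 2 - 2 * (k % 2 : ℕ)
  have hg4 : ∀ k, (4 : ℤ) ∣ g k := by
    intro k
    rcases Nat.even_or_odd' k with ⟨m, rfl | rfl⟩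
    · refine ⟨2 * m * s - 6 * m ^ 2, ?_⟩
      simp only [g]
      rw [show 2 * m % 2 = 0 by omega]; push_cast; ring
    · refine ⟨(2 * m + 1) * s - 6 * m ^ 2 - 6 * m - 2, ?_⟩
      simp only [g]
      rw [show (2 * m + 1) % 2 = 1 by omega]; push_cast; ring
  obtain ⟨k0, hk0, hk0'⟩ : ∃ k0 : ℕ, 2 * u ≤ k0 ∧ (k0 : ℝ) ≤ 2 * u + 1 :=
    ⟨⌈2 * u⌉₊, Nat.le_ceil _, (Nat.ceil_lt_add_one (by positivity)).le⟩
  obtain ⟨k1, hk1, hk1'⟩ : ∃ k1 : ℕ, 3 * k1 + 1 ≤ s ∧ s ≤ 3 * k1 + 3 := by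
    have : 1 ≤ s := by
      have : (1 : ℝ) ≤ s := by nlinarith
      exact_mod_cast this
    exact ⟨(s - 1) / 3, by omega, by omega⟩
  have hk1r : u ^ 2 / 4 ≤ k1 := by
    have : (s : ℝ) ≤ 3 * k1 + 3 := by exact_mod_cast hk1'
    nlinarith
  have hk01 : k0 ≤ k1 := by
    have : (k0 : ℝ) ≤ k1 := by nlinarith
    exact_mod_cast this
  have hk0pos : 1 ≤ k0 := by
    have : (1 : ℝ) ≤ k0 := by linarith
    exact_mod_cast this
  have hgk1 : d ≤ g k1 := by
    have a1 : 2 * (k1 : ℤ) * s ≤ g k1 := by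
      simp only [g]
      have : ((k1 % 2 : ℕ) : ℤ) ≤ 1 := by omega
      have b1 : (1 : ℤ) ≤ k1 := by omega
      have b2 : 3 * (k1 : ℤ) + 1 ≤ s := by exact_mod_cast hk1
      nlinarith
    have a2 : (d : ℝ) ≤ 2 * (k1 : ℝ) * s := by
      have c1 : (10000 * t) ^ 2 ≤ (u ^ 2) ^ 2 := by gcongr
      have c2 : u ^ 2 / 4 * u ^ 2 ≤ (k1 : ℝ) * s := by gcongr
      have c3 : 100 * u ^ 3 ≤ u * u ^ 3 := by gcongr
      nlinarith
    have a3 : d ≤ 2 * (k1 : ℤ) * s := by exact_mod_cast a2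
    linarith
  have hex : ∃ k, k0 ≤ k ∧ d ≤ g k := ⟨k1, hk01, hgk1⟩
  classical
  obtain ⟨k, hkdef⟩ : ∃ k, k = Nat.find hex := ⟨_, rfl⟩
  obtain ⟨hkk0, hkd⟩ : k0 ≤ k ∧ d ≤ g k := by rw [hkdef]; exact Nat.find_spec hex
  have hkk1 : k ≤ k1 := by rw [hkdef]; exact Nat.find_min' hex ⟨hk01, hgk1⟩
  have hdiff : g k - d ≤ 4 * s := by
    rcases hkk0.eq_or_lt with h | h
    · have a1 : (g k : ℝ) ≤ d := by
        rw [← h]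
        simp only [g]
        push_cast
        have b0' : (0 : ℤ) ≤ (k0 : ℤ) % 2 := by omega
        have b0 : (0 : ℝ) ≤ (((k0 : ℤ) % 2 : ℤ) : ℝ) := by exact_mod_cast b0'
        have b1 : (k0 : ℝ) * s ≤ (2 * u + 1) * (2 * u ^ 2) := by gcongr
        have b2 : 100 * u ^ 2 ≤ u * u ^ 2 := by gcongr
        have b3 := sq_nonneg (k0 : ℝ)
        have b4 : (2 * u + 1) * (2 * u ^ 2) = 4 * u ^ 3 + 2 * u ^ 2 := by ring
        have b5 : u * u ^ 2 = u ^ 3 := by ring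
        rw [b4] at b1
        rw [b5] at b2
        have b6 : 4 * (k0 : ℝ) * s = 4 * (k0 * s) := by ring
        rw [b6]
        have b7 : 0 ≤ u ^ 2 := by positivity
        linarith
      have a2 : g k ≤ d := by exact_mod_cast a1
      have : (0 : ℤ) ≤ s := by positivity
      linarith
    · obtain ⟨j, rfl⟩ : ∃ j, k = j + 1 := ⟨k - 1, by omega⟩
      have hj : ¬ (k0 ≤ j ∧ d ≤ g j) := by
        apply Nat.find_min hex; omega
      have hj' : g j < d := by
        by_contra hh
        exact hj ⟨by omega, by omega⟩
      have : g (j + 1) - g j ≤ 4 * s := by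
        simp only [g]
        have c1 : ((j % 2 : ℕ) : ℤ) ≤ 1 := by omega
        have c2 : (0 : ℤ) ≤ (((j + 1) % 2 : ℕ) : ℤ) := by omega
        have c3 : (0 : ℤ) ≤ j := by omega
        push_cast at c1 c2 ⊢
        nlinarith
      linarith
  obtain ⟨z, hz⟩ : (4 : ℤ) ∣ g k - d := dvd_sub (hg4 k) hd4
  obtain ⟨T, rfl⟩ : ∃ T : ℕ, z = T := ⟨z.toNat, by omega⟩
  have hTs : T ≤ s := by omega
  refine ⟨k, s, T, by omega, by omega, hsq, hse, ?_, ?_, hs2⟩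
  · have a1 : (2 * T : ℝ) ≤ k * (k + 1) := by
      have b1 : (T : ℝ) ≤ s := by exact_mod_cast hTs
      have b2 : (k0 : ℝ) ≤ k := by exact_mod_cast hkk0
      have b3 : 2 * u ≤ k := by linarith
      have b4 : (2 * u) * (2 * u) ≤ (k : ℝ) * k := by gcongr
      nlinarith
    exact_mod_cast a1
  · have : (w : ℤ) = s * q - d := by rw [hd]; ring
    rw [this]
    have e : d = g k - 4 * T := by linarith
    rw [e]
    simp only [g]
    ring

/-- There is an absolute constant `C > 0` such that
`w/q ≤ f(w) ≤ w/q + C(w^{3/2}/q^{5/2} + 1)` for all even `w` with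
`C·q^{3/2} ≤ w ≤ N − C·q^{3/2}`, for every odd prime power `q` (realized as
the cardinality of a finite field `F`). -/
theorem stmt13 :
    ∃ C : ℝ, 0 < C ∧
      ∀ (F : Type) [Field F] [Fintype F], ∀ q : ℕ,
        Fintype.card F = q → Odd q →
        ∀ w : ℕ, Even w →
          C * (q : ℝ) ^ ((3 : ℝ) / 2) ≤ (w : ℝ) →
          (w : ℝ) ≤ ((q : ℝ) ^ 2 + q + 1) - C * (q : ℝ) ^ ((3 : ℝ) / 2) →
          (w : ℝ) / q ≤ (fmin F w : ℝ) ∧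
          (fmin F w : ℝ) ≤
            (w : ℝ) / q + C * ((w : ℝ) ^ ((3 : ℝ) / 2) / (q : ℝ) ^ ((5 : ℝ) / 2) + 1) := by
  refine ⟨10000, by norm_num, ?_⟩
  intro F _ _ q hcard hqo w hwe h1 h2
  have hq0 : (0 : ℝ) < q := by exact_mod_cast hqo.pos
  have hw0 : (0 : ℝ) ≤ w := by positivity
  obtain ⟨t, ht⟩ : ∃ t : ℝ, t = √(q : ℝ) := ⟨_, rfl⟩
  obtain ⟨u, hu⟩ : ∃ u : ℝ, u = √((w : ℝ) / q) := ⟨_, rfl⟩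
  have ht0 : 0 < t := by rw [ht]; exact Real.sqrt_pos.2 hq0
  have hu0 : 0 ≤ u := by rw [hu]; positivity
  have htq : t ^ 2 = q := by rw [ht]; exact Real.sq_sqrt hq0.le
  have huw : u ^ 2 = (w : ℝ) / q := by rw [hu]; exact Real.sq_sqrt (by positivity)
  have htu : t ^ 2 * u ^ 2 = w := by rw [htq, huw]; field_simp
  have e3 : (q : ℝ) ^ ((3 : ℝ) / 2) = t ^ 3 := by
    rw [← htq, ← Real.rpow_natCast, ← Real.rpow_natCast, ← Real.rpow_mul ht0.le]
    norm_num
  have e5 : (q : ℝ) ^ ((5 : ℝ) / 2) = t ^ 5 := by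
    rw [← htq, ← Real.rpow_natCast, ← Real.rpow_natCast, ← Real.rpow_mul ht0.le]
    norm_num
  have ew : (w : ℝ) ^ ((3 : ℝ) / 2) = (t * u) ^ 3 := by
    rw [← htu, ← mul_pow, ← Real.rpow_natCast, ← Real.rpow_natCast,
      ← Real.rpow_mul (by positivity)]
    norm_num
  have eq : (w : ℝ) ^ ((3 : ℝ) / 2) / (q : ℝ) ^ ((5 : ℝ) / 2) = u ^ 3 / t ^ 2 := by
    rw [e5, ew]; field_simp
  rw [eq]
  rw [e3] at h1 h2
  obtain ⟨k, s, T, hk1, hks, hsq, hse, hT, hw, hsb⟩ :=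
    numerics q w hqo hwe t u ht0.le hu0 htq htu h1 h2
  obtain ⟨S, hS, hL⟩ := construct (F := F) k s T hk1 hks (by rw [hcard]; exact hsq) hse hT
  have hLw : (Lodd F S).ncard = w := by
    rw [hcard, ← hw] at hL
    exact_mod_cast hL
  have hodd : Odd (Fintype.card F) := by rw [hcard]; exact hqo
  have hmem : s ∈ {n | ∃ R : Set (PG F), R.ncard = w ∧ (Podd F R).ncard = n} := by
    refine ⟨Lodd F S, hLw, ?_⟩
    rw [Lodd_eq_Podd, podd_podd hodd S (by rw [hS]; exact hse), hS]
  constructor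
  · obtain ⟨R, hR, hn⟩ := Nat.sInf_mem ⟨s, hmem⟩
    have h := lower_bound hodd R (by rw [hR]; exact hwe)
    rw [hR, hn, hcard] at h
    rw [div_le_iff₀ hq0]
    exact_mod_cast h
  · have h : fmin F w ≤ s := Nat.sInf_le hmem
    have h' : (fmin F w : ℝ) ≤ s := by exact_mod_cast h
    rw [← huw]
    have h0 : 0 ≤ u ^ 3 / t ^ 2 := by positivity
    have e : 24 * u ^ 3 / t ^ 2 = 24 * (u ^ 3 / t ^ 2) := by ring
    rw [e] at hsb
    linarith
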